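/- The convergent series ∑_{k=0}^∞ (2^k·C(3k,k)/27^k)·(3H_{3k} − 2H_{2k} − H_k − 3·log 3) equals −((3+√3)/2)·log 2 − √3·log(2+√3). -/

import Mathlib

open scoped BigOperators

/-- The `m`-th harmonic number `H_m = ∑_{j=1}^m 1/j`. -/
noncomputable def harmonicNum (m : ℕ) : ℝ := ∑ j ∈ Finset.range m, 1 / (j + 1 : ℝ)

section

open Complex Metric

/-- Term-by-term integration of a geometric series over a circle. -/
lemma hasSum_circleIntegral_geometric {f w : ℂ → ℂ} {c : ℂ} {R q : ℝ} (hR : 0 ≤ R)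
    (hf : ContinuousOn f (sphere c R)) (hw : ContinuousOn w (sphere c R))
    (hq : q < 1) (hwq : ∀ z ∈ sphere c R, ‖w z‖ ≤ q) :
    HasSum (fun k : ℕ => ∮ z in C(c, R), w z ^ k * f z) (∮ z in C(c, R), (1 - w z)⁻¹ * f z) := by
  have hmem : ∀ θ, circleMap c R θ ∈ sphere c R := circleMap_mem_sphere c hR
  have hq0 : 0 ≤ q := (norm_nonneg _).trans (hwq _ (hmem 0))
  have hfc : Continuous fun θ => f (circleMap c R θ) :=
    hf.comp_continuous (continuous_circleMap c R) hmem
  have hwc : Continuous fun θ => w (circleMap c R θ) :=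
    hw.comp_continuous (continuous_circleMap c R) hmem
  refine intervalIntegral.hasSum_integral_of_dominated_convergence
    (fun n θ => q ^ n * (R * ‖f (circleMap c R θ)‖)) (fun n => ?_) (fun n => ?_) ?_ ?_ ?_
  · simp only [deriv_circleMap]
    exact (((continuous_circleMap 0 R).mul continuous_const).smul
      ((hwc.pow n).mul hfc)).aestronglyMeasurable
  · refine Filter.Eventually.of_forall fun θ _ => ?_
    have h := pow_le_pow_left₀ (norm_nonneg _) (hwq _ (hmem θ)) n
    simp only [deriv_circleMap, norm_smul, norm_mul, norm_pow, norm_circleMap_zero, norm_I,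
      mul_one, abs_of_nonneg hR]
    calc _ = ‖w (circleMap c R θ)‖ ^ n * (R * ‖f (circleMap c R θ)‖) := by ring
      _ ≤ _ := by gcongr
  · exact Filter.Eventually.of_forall fun _ _ => (summable_geometric_of_lt_one hq0 hq).mul_right _
  · simp only [tsum_mul_right]
    exact (continuous_const.mul (continuous_const.mul hfc.norm)).intervalIntegrable _ _
  · refine Filter.Eventually.of_forall fun θ _ => HasSum.const_smul _ (HasSum.mul_right _ ?_)
    exact hasSum_geometric_of_norm_lt_one ((hwq _ (hmem θ)).trans_lt hq)

/-- Integration by parts for the Taylor coefficients of `(1 + z) ^ n * g z`. -/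
lemma circleIntegral_one_add_pow_recursion {g g' : ℂ → ℂ} {R : ℝ} (hR : 0 < R)
    (hg : ∀ z ∈ sphere (0 : ℂ) R, HasDerivAt g (g' z) z) (hg' : ContinuousOn g' (sphere 0 R))
    (n m : ℕ) :
    (m + 1 : ℂ) * (∮ z in C(0, R), (1 + z) ^ n * g z * (z ^ (m + 2))⁻¹) =
      (n - m) * (∮ z in C(0, R), (1 + z) ^ n * g z * (z ^ (m + 1))⁻¹) +
        ∮ z in C(0, R), (1 + z) ^ n * ((1 + z) * g' z) * (z ^ (m + 1))⁻¹ := by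
  have h0 : ∀ z ∈ sphere (0 : ℂ) R, z ≠ 0 := fun z hz => ne_of_mem_sphere hz hR.ne'
  have hgc : ContinuousOn g (sphere 0 R) := fun z hz => (hg z hz).continuousAt.continuousWithinAt
  have hinv : ∀ j : ℕ, ContinuousOn (fun z : ℂ => (z ^ j)⁻¹) (sphere 0 R) := fun j =>
    (continuous_pow j).continuousOn.inv₀ fun z hz => pow_ne_zero _ (h0 z hz)
  have hp : ContinuousOn (fun z : ℂ => (1 + z) ^ n) (sphere 0 R) := by fun_prop
  have hq : ContinuousOn (fun z : ℂ => 1 + z) (sphere 0 R) := by fun_prop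
  have i1 : CircleIntegrable (fun z => (n - m : ℂ) * ((1 + z) ^ n * g z * (z ^ (m + 1))⁻¹)) 0 R :=
    (continuousOn_const.mul ((hp.mul hgc).mul (hinv _))).circleIntegrable hR.le
  have i2 : CircleIntegrable (fun z => (1 + z) ^ n * ((1 + z) * g' z) * (z ^ (m + 1))⁻¹) 0 R :=
    ((hp.mul (hq.mul hg')).mul (hinv _)).circleIntegrable hR.le
  have i3 : CircleIntegrable (fun z => (m + 1 : ℂ) * ((1 + z) ^ n * g z * (z ^ (m + 2))⁻¹)) 0 R :=
    (continuousOn_const.mul ((hp.mul hgc).mul (hinv _))).circleIntegrable hR.le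
  have key : (∮ z in C(0, R), ((n - m : ℂ) * ((1 + z) ^ n * g z * (z ^ (m + 1))⁻¹) +
      (1 + z) ^ n * ((1 + z) * g' z) * (z ^ (m + 1))⁻¹) -
      (m + 1 : ℂ) * ((1 + z) ^ n * g z * (z ^ (m + 2))⁻¹)) = 0 := by
    refine circleIntegral.integral_eq_zero_of_hasDerivWithinAt
      (f := fun z => (1 + z) ^ (n + 1) * g z * (z ^ (m + 1))⁻¹) hR.le fun z hz => ?_
    have hz0 := h0 z hz
    have hd := (((((hasDerivAt_id z).const_add 1).fun_pow (n + 1)).mul (hg z hz)).mul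
      (((hasDerivAt_id z).fun_pow (m + 1)).inv (pow_ne_zero _ hz0))).hasDerivWithinAt
        (s := sphere 0 R)
    refine hd.congr_deriv ?_
    simp only [id_eq, Nat.add_sub_cancel, Nat.cast_add, Nat.cast_one, Pi.mul_apply, Pi.inv_apply]
    field_simp
    ring
  have hsub := circleIntegral.integral_sub (i1.add i2) i3
  simp only [Pi.add_apply] at hsub
  rw [hsub, circleIntegral.integral_add i1 i2,
    circleIntegral.integral_const_mul, circleIntegral.integral_const_mul, sub_eq_zero] at key
  exact key.symm

lemma circleIntegral_mul_inv_sub {f : ℂ → ℂ} {R : ℝ} {w : ℂ} (hw : ‖w‖ < R)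
    (hf : DifferentiableOn ℂ f (closedBall 0 R)) :
    (∮ z in C(0, R), f z * (z - w)⁻¹) = 2 * Real.pi * I * f w := by
  have := hf.circleIntegral_sub_inv_smul (w := w) (by simpa using hw)
  simpa [mul_comm] using this

lemma circleIntegral_one_add_pow {R : ℝ} (hR : 0 < R) (n m : ℕ) :
    (∮ z in C(0, R), (1 + z) ^ n * 1 * (z ^ (m + 1))⁻¹) = 2 * Real.pi * I * n.choose m := by
  induction m with
  | zero =>
    have := circleIntegral_mul_inv_sub (f := fun z => (1 + z) ^ n * 1) (R := R) (w := 0)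
      (by simpa using hR) (by fun_prop)
    simpa using this
  | succ m ih =>
    have h := circleIntegral_one_add_pow_recursion (g := fun _ => 1) (g' := fun _ => 0) hR
      (fun z _ => hasDerivAt_const z 1) continuousOn_const n m
    rw [ih] at h
    have hc : ((n.choose (m + 1) : ℕ) : ℂ) * (m + 1) = n.choose m * (n - m) := by
      rcases le_or_gt m n with hmn | hmn
      · have := Nat.choose_succ_right_eq n m
        rw [← Nat.cast_sub hmn]
        exact_mod_cast this
      · simp [Nat.choose_eq_zero_of_lt hmn, Nat.choose_eq_zero_of_lt (hmn.trans (Nat.lt_succ_self m))]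
    have hm : (m + 1 : ℂ) ≠ 0 := Nat.cast_add_one_ne_zero m
    refine mul_left_cancel₀ hm (h.trans ?_)
    have h0 : (∮ z in C(0, R), (1 + z) ^ n * ((1 + z) * 0) * (z ^ (m + 1))⁻¹) = 0 := by
      simp [circleIntegral]
    rw [h0]
    linear_combination -(2 * Real.pi * I) * hc

lemma differentiableOn_log_one_add {R : ℝ} (hR : R < 1) :
    DifferentiableOn ℂ (fun z => log (1 + z)) (closedBall 0 R) := fun z hz =>
  (DifferentiableAt.clog (by fun_prop) (mem_slitPlane_of_norm_lt_one
    ((mem_closedBall_zero_iff.1 hz).trans_lt hR))).differentiableWithinAt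

lemma harmonicNum_succ (m : ℕ) : harmonicNum (m + 1) = harmonicNum m + 1 / (m + 1) := by
  simp [harmonicNum, Finset.sum_range_succ]

lemma circleIntegral_one_add_pow_mul_log {R : ℝ} (hR : 0 < R) (hR1 : R < 1) {n m : ℕ}
    (hmn : m ≤ n) :
    (∮ z in C(0, R), (1 + z) ^ n * log (1 + z) * (z ^ (m + 1))⁻¹) =
      2 * Real.pi * I * (n.choose m * (harmonicNum n - harmonicNum (n - m)) : ℝ) := by
  induction m with
  | zero =>
    have := circleIntegral_mul_inv_sub (f := fun z => (1 + z) ^ n * log (1 + z)) (R := R) (w := 0)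
      (by simpa using hR)
      (DifferentiableOn.mul (by fun_prop) (differentiableOn_log_one_add hR1))
    simpa using this
  | succ m ih =>
    have hs : ∀ z ∈ sphere (0 : ℂ) R, 1 + z ∈ slitPlane := fun z hz =>
      mem_slitPlane_of_norm_lt_one (by rwa [mem_sphere_zero_iff_norm.1 hz])
    have h := circleIntegral_one_add_pow_recursion (g := fun z => log (1 + z))
      (g' := fun z => 1 / (1 + z)) hR
      (fun z hz => ((hasDerivAt_id z).const_add 1).clog (hs z hz))
      (ContinuousOn.div continuousOn_const (by fun_prop)
        fun z hz => slitPlane_ne_zero (hs z hz)) n m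
    have h1 : (∮ z in C(0, R), (1 + z) ^ n * ((1 + z) * (1 / (1 + z))) * (z ^ (m + 1))⁻¹) =
        2 * Real.pi * I * n.choose m := by
      rw [← circleIntegral_one_add_pow hR]
      refine circleIntegral.integral_congr hR.le fun z hz => ?_
      simp only [mul_one_div_cancel (slitPlane_ne_zero (hs z hz))]
    rw [h1, ih (Nat.le_of_succ_le hmn)] at h
    obtain ⟨d, rfl⟩ := Nat.exists_eq_add_of_le hmn
    have e1 : m + 1 + d - m = d + 1 := by omega
    have e2 : m + 1 + d - (m + 1) = d := by omega
    have hc : (((m + 1 + d).choose (m + 1) : ℕ) : ℝ) * (m + 1) = (m + 1 + d).choose m * (d + 1) := by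
      have := Nat.choose_succ_right_eq (m + 1 + d) m
      rw [e1] at this
      exact_mod_cast this
    have hm : (m + 1 : ℂ) ≠ 0 := Nat.cast_add_one_ne_zero m
    refine mul_left_cancel₀ hm (h.trans ?_)
    rw [e1, e2, harmonicNum_succ]
    have hd : (d + 1 : ℝ) ≠ 0 := Nat.cast_add_one_ne_zero d
    have hr : ((d : ℝ) + 1) * ((m + 1 + d).choose m *
        (harmonicNum (m + 1 + d) - (harmonicNum d + 1 / (d + 1)))) + (m + 1 + d).choose m =
        (m + 1) * ((m + 1 + d).choose (m + 1) * (harmonicNum (m + 1 + d) - harmonicNum d)) := by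
      field_simp
      linear_combination -(harmonicNum (m + 1 + d) - harmonicNum d) * hc
    have hr' := congrArg (fun x : ℝ => (x : ℂ)) hr
    push_cast at hr' ⊢
    linear_combination 2 * Real.pi * I * hr'

lemma norm_one_add_cube_le {z : ℂ} (hz : ‖z‖ = 2 / 3) : ‖(1 + z) ^ 3‖ ≤ 125 / 27 := by
  have h : ‖1 + z‖ ≤ 5 / 3 := (norm_add_le _ _).trans (by rw [hz, norm_one]; norm_num)
  rw [norm_pow]
  exact (pow_le_pow_left₀ (norm_nonneg _) h 3).trans (by norm_num)

lemma sqrt_three_bounds : 1.73 < √3 ∧ √3 < 1.74 :=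
  ⟨Real.lt_sqrt_of_sq_lt (by norm_num), (Real.sqrt_lt' (by norm_num)).2 (by norm_num)⟩

lemma ofReal_sqrt_three_sq : ((√3 : ℝ) : ℂ) ^ 2 = 3 := by
  rw [← ofReal_pow, Real.sq_sqrt (by norm_num)]
  norm_num

lemma sub_ofReal_ne_zero_of_norm_le {z : ℂ} {R a : ℝ} (hz : ‖z‖ ≤ R) (ha : R < |a|) :
    z - a ≠ 0 := by
  intro h
  rw [sub_eq_zero.1 h, norm_real, Real.norm_eq_abs] at hz
  linarith

/-- Lagrange inversion for `z = (2 / 27) * (1 + z) ^ 3`. -/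
lemma hasSum_lagrange {g : ℂ → ℂ} (hg : DifferentiableOn ℂ g (closedBall 0 (2 / 3))) :
    HasSum (fun k : ℕ => (2 / 27) ^ k * ∮ z in C(0, 2 / 3),
        (1 + z) ^ (3 * k) * g z * (z ^ (k + 1))⁻¹)
      (2 * Real.pi * I * ((1 + √3) / 2 * g (((3 * √3 - 5) / 2 : ℝ) : ℂ))) := by
  obtain ⟨hs1, hs2⟩ := sqrt_three_bounds
  have hs := ofReal_sqrt_three_sq
  have h0 : ∀ z ∈ sphere (0 : ℂ) (2 / 3), z ≠ 0 := fun z hz => ne_of_mem_sphere hz (by norm_num)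
  have h := hasSum_circleIntegral_geometric (f := fun z => g z * z⁻¹)
    (w := fun z => 2 / 27 * (1 + z) ^ 3 * z⁻¹) (c := 0) (R := 2 / 3) (q := 125 / 243) (by norm_num)
    ((hg.continuousOn.mono sphere_subset_closedBall).mul (continuousOn_id.inv₀ h0))
    (ContinuousOn.mul (by fun_prop) (continuousOn_id.inv₀ h0)) (by norm_num) (fun z hz => by
      have hz' := mem_sphere_zero_iff_norm.1 hz
      have := norm_one_add_cube_le hz'
      rw [norm_mul, norm_mul, norm_inv, hz']
      norm_num at this ⊢
      linarith)
  set a : ℝ := (3 * √3 - 5) / 2 with ha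
  set b : ℝ := -(3 * √3 + 5) / 2 with hb
  have hac : (a : ℂ) = (3 * √3 - 5) / 2 := by rw [ha]; push_cast; ring
  have hbc : (b : ℂ) = -(3 * √3 + 5) / 2 := by rw [hb]; push_cast; ring
  have haR : ‖(a : ℂ)‖ < 2 / 3 := by
    rw [norm_real, Real.norm_eq_abs, abs_lt]
    constructor <;> linarith
  have hne2 : ∀ z : ℂ, ‖z‖ ≤ 2 / 3 → z - 2 ≠ 0 := fun z hz => by
    have := sub_ofReal_ne_zero_of_norm_le (a := 2) hz (by norm_num)
    simpa using this
  have hneb : ∀ z : ℂ, ‖z‖ ≤ 2 / 3 → z - b ≠ 0 := fun z hz =>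
    sub_ofReal_ne_zero_of_norm_le hz (by rw [lt_abs]; right; linarith)
  have hF : DifferentiableOn ℂ (fun z => g z * (-(2 / 27) * (z - 2) * (z - b))⁻¹)
      (closedBall 0 (2 / 3)) := by
    refine hg.mul (DifferentiableOn.inv (by fun_prop) fun z hz => ?_)
    have hz := mem_closedBall_zero_iff.1 hz
    exact mul_ne_zero (mul_ne_zero (by norm_num) (hne2 z hz)) (hneb z hz)
  have hI := circleIntegral_mul_inv_sub haR hF
  have hlim : (∮ z in C(0, 2 / 3), (1 - 2 / 27 * (1 + z) ^ 3 * z⁻¹)⁻¹ * (g z * z⁻¹)) =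
      ∮ z in C(0, 2 / 3), g z * (-(2 / 27) * (z - 2) * (z - b))⁻¹ * (z - a)⁻¹ := by
    refine circleIntegral.integral_congr (by norm_num) fun z hz => ?_
    have hz0 := h0 z hz
    have e : (1 - 2 / 27 * (1 + z) ^ 3 * z⁻¹) * z = -(2 / 27) * (z - 2) * (z - b) * (z - a) := by
      rw [sub_mul, inv_mul_cancel_right₀ hz0, hac, hbc]
      linear_combination (-(1 / 6) * (z - 2)) * hs
    calc _ = g z * ((1 - 2 / 27 * (1 + z) ^ 3 * z⁻¹) * z)⁻¹ := by rw [mul_inv]; ring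
      _ = _ := by rw [e, mul_inv]; ring
  have hval : (-(2 / 27) * ((a : ℂ) - 2) * (a - b))⁻¹ = (1 + √3) / 2 := by
    refine inv_eq_of_mul_eq_one_right ?_
    rw [hac, hbc]
    linear_combination (-(√3 : ℂ) / 6 + 1 / 3) * hs
  rw [hlim, hI, hval] at h
  convert! h using 1
  · funext k
    rw [← circleIntegral.integral_const_mul]
    refine circleIntegral.integral_congr (by norm_num) fun z hz => ?_
    simp only [mul_pow, inv_pow, ← pow_mul, pow_succ z k, mul_inv]
    ring
  · ring

/-- Lagrange inversion for both small roots of `z ^ 2 = (2 / 27) * (1 + z) ^ 3`. -/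
lemma hasSum_lagrange_even {g : ℂ → ℂ} (hg : DifferentiableOn ℂ g (closedBall 0 (2 / 3))) :
    HasSum (fun k : ℕ => (2 / 27) ^ k * ∮ z in C(0, 2 / 3),
        (1 + z) ^ (3 * k) * g z * (z ^ (2 * k + 1))⁻¹)
      (2 * Real.pi * I * (g ((1 / 2 : ℝ) : ℂ) + (√3 - 1) / 2 * g ((5 - 3 * √3 : ℝ) : ℂ))) := by
  obtain ⟨hs1, hs2⟩ := sqrt_three_bounds
  have hs := ofReal_sqrt_three_sq
  have h0 : ∀ z ∈ sphere (0 : ℂ) (2 / 3), z ≠ 0 := fun z hz => ne_of_mem_sphere hz (by norm_num)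
  have h := hasSum_circleIntegral_geometric (f := fun z => g z * z⁻¹)
    (w := fun z => 2 / 27 * (1 + z) ^ 3 * (z⁻¹) ^ 2) (c := 0) (R := 2 / 3) (q := 125 / 162)
    (by norm_num)
    ((hg.continuousOn.mono sphere_subset_closedBall).mul (continuousOn_id.inv₀ h0))
    (ContinuousOn.mul (by fun_prop) ((continuousOn_id.inv₀ h0).pow 2)) (by norm_num) (fun z hz => by
      have hz' := mem_sphere_zero_iff_norm.1 hz
      have := norm_one_add_cube_le hz'
      rw [norm_mul, norm_mul, norm_pow _ 2, norm_inv, hz']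
      norm_num at this ⊢
      linarith)
  obtain ⟨a, ha⟩ : ∃ a : ℝ, a = 1 / 2 := ⟨_, rfl⟩
  obtain ⟨b, hb⟩ : ∃ b : ℝ, b = 5 - 3 * √3 := ⟨_, rfl⟩
  obtain ⟨c, hc⟩ : ∃ c : ℝ, c = 5 + 3 * √3 := ⟨_, rfl⟩
  rw [← ha, ← hb]
  have hac : (a : ℂ) = 1 / 2 := by rw [ha]; push_cast; ring
  have hbc : (b : ℂ) = 5 - 3 * √3 := by rw [hb]; push_cast; ring
  have hcc : (c : ℂ) = 5 + 3 * √3 := by rw [hc]; push_cast; ring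
  have haR : ‖(a : ℂ)‖ < 2 / 3 := by
    rw [norm_real, Real.norm_eq_abs, abs_lt]
    constructor <;> linarith
  have hbR : ‖(b : ℂ)‖ < 2 / 3 := by
    rw [norm_real, Real.norm_eq_abs, abs_lt]
    constructor <;> linarith
  have hab : (a : ℂ) - b ≠ 0 := by
    rw [← ofReal_sub, ofReal_ne_zero]
    intro h
    rw [ha, hb] at h
    linarith
  have hnec : ∀ z : ℂ, ‖z‖ ≤ 2 / 3 → z - c ≠ 0 := fun z hz =>
    sub_ofReal_ne_zero_of_norm_le hz (by rw [lt_abs]; left; linarith)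
  have hF : DifferentiableOn ℂ (fun z => g z * (z * (-(2 / 27) * (z - c) * (a - b))⁻¹))
      (closedBall 0 (2 / 3)) := by
    refine hg.mul (differentiableOn_id.mul (DifferentiableOn.inv (by fun_prop) fun z hz => ?_))
    have hz := mem_closedBall_zero_iff.1 hz
    exact mul_ne_zero (mul_ne_zero (by norm_num) (hnec z hz)) hab
  have hsub : ∀ w : ℂ, ‖w‖ < 2 / 3 → ∀ z ∈ sphere (0 : ℂ) (2 / 3), z - w ≠ 0 := fun w hw z hz h => by
    rw [sub_eq_zero.1 h, mem_sphere_zero_iff_norm] at hz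
    linarith
  have hint : ∀ w : ℂ, ‖w‖ < 2 / 3 → CircleIntegrable
      (fun z => g z * (z * (-(2 / 27) * (z - c) * (a - b))⁻¹) * (z - w)⁻¹) 0 (2 / 3) := fun w hw =>
    ((hF.continuousOn.mono sphere_subset_closedBall).mul
      (ContinuousOn.inv₀ (by fun_prop) (hsub w hw))).circleIntegrable (by norm_num)
  have hI := circleIntegral.integral_sub (hint a haR) (hint b hbR)
  rw [circleIntegral_mul_inv_sub haR hF, circleIntegral_mul_inv_sub hbR hF] at hI
  have hlim : (∮ z in C(0, 2 / 3), (1 - 2 / 27 * (1 + z) ^ 3 * (z⁻¹) ^ 2)⁻¹ * (g z * z⁻¹)) =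
      ∮ z in C(0, 2 / 3), (g z * (z * (-(2 / 27) * (z - c) * (a - b))⁻¹) * (z - a)⁻¹ -
        g z * (z * (-(2 / 27) * (z - c) * (a - b))⁻¹) * (z - b)⁻¹) := by
    refine circleIntegral.integral_congr (by norm_num) fun z hz => ?_
    have hz0 := h0 z hz
    have hza := hsub a haR z hz
    have hzb := hsub b hbR z hz
    have hzc := hnec z (mem_sphere_zero_iff_norm.1 hz).le
    have e : (1 - 2 / 27 * (1 + z) ^ 3 * (z⁻¹) ^ 2) * z =
        -(2 / 27) * (z - c) * ((z - a) * (z - b)) * z⁻¹ := by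
      rw [hac, hbc, hcc]
      field_simp
      linear_combination (-18 * (z - 1 / 2)) * hs
    have hpf : (z - a)⁻¹ - (z - b)⁻¹ = (a - b) * ((z - a) * (z - b))⁻¹ := by
      field_simp
      ring
    calc _ = g z * ((1 - 2 / 27 * (1 + z) ^ 3 * (z⁻¹) ^ 2) * z)⁻¹ := by rw [mul_inv]; ring
      _ = g z * (z * (-(2 / 27) * (z - c) * (a - b))⁻¹) * ((a - b) * ((z - a) * (z - b))⁻¹) := by
        rw [e]
        field_simp
      _ = _ := by rw [← hpf]; ring
  have hvala : (a : ℂ) * (-(2 / 27) * ((a : ℂ) - c) * (a - b))⁻¹ = 1 := by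
    rw [← div_eq_mul_inv, div_eq_one_iff_eq]
    · rw [hac, hbc, hcc]
      linear_combination (-(2 / 3)) * hs
    · exact mul_ne_zero (mul_ne_zero (by norm_num) (hnec _ haR.le)) hab
  have hvalb : (b : ℂ) * (-(2 / 27) * ((b : ℂ) - c) * (a - b))⁻¹ = -((√3 - 1) / 2) := by
    rw [← div_eq_mul_inv, div_eq_iff]
    · rw [hac, hbc, hcc]
      linear_combination ((2 / 3) * (√3 : ℂ) - 5 / 3) * hs
    · exact mul_ne_zero (mul_ne_zero (by norm_num) (hnec _ hbR.le)) hab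
  rw [hlim, hI, hvala, hvalb] at h
  convert! h using 1
  · funext k
    rw [← circleIntegral.integral_const_mul]
    refine circleIntegral.integral_congr (by norm_num) fun z hz => ?_
    simp only [mul_pow, inv_pow, ← pow_mul, pow_succ z (2 * k), mul_inv]
    ring
  · ring

lemma log_one_add_ofReal {x y : ℝ} (h : 1 + x = y) (hy : 0 ≤ y) :
    log (1 + (x : ℂ)) = Real.log y := by
  rw [ofReal_log hy, ← h, ofReal_add, ofReal_one]

lemma hasSum_choose_three_mul :
    HasSum (fun k : ℕ => (2 / 27 : ℝ) ^ k * ((3 * k).choose k : ℝ)) ((1 + √3) / 2) := by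
  have h := hasSum_lagrange (g := fun _ => 1) (differentiableOn_const 1)
  simp only [circleIntegral_one_add_pow (show (0 : ℝ) < 2 / 3 by norm_num)] at h
  rw [← Complex.hasSum_ofReal, ← hasSum_mul_left_iff two_pi_I_ne_zero]
  convert! h using 1
  · funext k
    push_cast
    ring
  · push_cast
    ring

lemma hasSum_choose_three_mul_harmonic_two :
    HasSum (fun k : ℕ => (2 / 27 : ℝ) ^ k *
        (((3 * k).choose k : ℝ) * (harmonicNum (3 * k) - harmonicNum (2 * k))))
      ((1 + √3) / 2 * Real.log (3 * (√3 - 1) / 2)) := by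
  obtain ⟨hs1, hs2⟩ := sqrt_three_bounds
  have h := hasSum_lagrange (differentiableOn_log_one_add (R := 2 / 3) (by norm_num))
  rw [← Complex.hasSum_ofReal, ← hasSum_mul_left_iff two_pi_I_ne_zero]
  convert! h using 1
  · funext k
    rw [circleIntegral_one_add_pow_mul_log (by norm_num) (by norm_num) (by omega),
      show 3 * k - k = 2 * k by omega]
    push_cast
    ring
  · rw [log_one_add_ofReal (y := 3 * (√3 - 1) / 2) (by ring) (by linarith)]
    push_cast
    ring

lemma hasSum_choose_three_mul_harmonic_one :
    HasSum (fun k : ℕ => (2 / 27 : ℝ) ^ k *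
        (((3 * k).choose k : ℝ) * (harmonicNum (3 * k) - harmonicNum k)))
      (Real.log (3 / 2) + (√3 - 1) / 2 * Real.log (3 * (2 - √3))) := by
  obtain ⟨hs1, hs2⟩ := sqrt_three_bounds
  have h := hasSum_lagrange_even (differentiableOn_log_one_add (R := 2 / 3) (by norm_num))
  rw [← Complex.hasSum_ofReal, ← hasSum_mul_left_iff two_pi_I_ne_zero]
  convert! h using 1
  · funext k
    rw [circleIntegral_one_add_pow_mul_log (by norm_num) (by norm_num) (by omega),
      show 3 * k - 2 * k = k by omega, Nat.choose_symm_of_eq_add (show 3 * k = 2 * k + k by omega)]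
    push_cast
    ring
  · rw [log_one_add_ofReal (y := 3 / 2) (by norm_num) (by norm_num),
      log_one_add_ofReal (y := 3 * (2 - √3)) (by ring) (by linarith)]
    push_cast
    ring

lemma log_two_sub_sqrt_three : Real.log (2 - √3) = -Real.log (2 + √3) := by
  rw [← Real.log_inv]
  congr 1
  refine eq_inv_of_mul_eq_one_left ?_
  linear_combination -Real.sq_sqrt (show (0 : ℝ) ≤ 3 by norm_num)

lemma log_sqrt_three_sub_one :
    2 * Real.log (√3 - 1) = Real.log 2 - Real.log (2 + √3) := by
  obtain ⟨hs1, hs2⟩ := sqrt_three_bounds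
  have hmul : Real.log (2 * (2 - √3)) = Real.log 2 + Real.log (2 - √3) :=
    Real.log_mul (by norm_num) (by linarith)
  have hsq : 2 * (2 - √3) = (√3 - 1) ^ 2 := by
    linear_combination -Real.sq_sqrt (show (0 : ℝ) ≤ 3 by norm_num)
  rw [hsq, Real.log_pow, log_two_sub_sqrt_three] at hmul
  exact_mod_cast hmul

end

theorem sun_3k_hbar :
    ∑' k : ℕ, (2 ^ k * (Nat.choose (3 * k) k : ℝ) / 27 ^ k) *
        (3 * harmonicNum (3 * k) - 2 * harmonicNum (2 * k) - harmonicNum k - 3 * Real.log 3) =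
      -((3 + Real.sqrt 3) / 2) * Real.log 2 - Real.sqrt 3 * Real.log (2 + Real.sqrt 3) := by
  obtain ⟨hs1, hs2⟩ := sqrt_three_bounds
  have h := ((hasSum_choose_three_mul_harmonic_two.mul_left 2).add
    hasSum_choose_three_mul_harmonic_one).sub (hasSum_choose_three_mul.mul_left (3 * Real.log 3))
  have e := log_sqrt_three_sub_one
  rw [Real.log_div (by linarith) (by norm_num), Real.log_mul (by norm_num) (by linarith),
    Real.log_div (by norm_num) (by norm_num), Real.log_mul (by norm_num) (by linarith),
    log_two_sub_sqrt_three] at h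
  refine Eq.trans (tsum_congr fun k => ?_) (h.tsum_eq.trans ?_)
  · rw [div_pow]
    ring
  · linear_combination (1 + √3) / 2 * e
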